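/- arXiv:quant-ph/0510151 — 6 statements merged into one kernel-verified Lean document; each statement's English description precedes it below -/
import Mathlib

section
/- Let F be a real 2d×2d symplectic matrix with d×d block decomposition F = [[A, B],[C, D]], and define the complex 2d×2d matrix V_F = ½(𝟙 + F + iJ(𝟙 - F)). Then det V_F = det(½(A + D + i(B - C))). -/
open Matrix

/-- The standard symplectic matrix `J = [[0, 𝟙],[-𝟙, 0]]` (paper's sign convention). -/
def standardJ (d : ℕ) (R : Type*) [CommRing R] :
    Matrix (Fin d ⊕ Fin d) (Fin d ⊕ Fin d) R :=
  Matrix.fromBlocks 0 1 (-1) 0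

/-- Shearing along `Complex.I` turns `½(𝟙 + F + iJ(𝟙 - F))` into a block upper triangular matrix
with diagonal blocks `½(A + D + i(B - C))` and `𝟙`. -/
theorem half_one_add_add_standardJ_mul_eq (d : ℕ) (A B C D : Matrix (Fin d) (Fin d) ℂ) :
    (1 / 2 : ℂ) • (1 + fromBlocks A B C D
        + Complex.I • (standardJ d ℂ * (1 - fromBlocks A B C D)))
      = fromBlocks 1 0 (Complex.I • 1) 1
        * fromBlocks ((1 / 2 : ℂ) • (A + D + Complex.I • (B - C)))
            ((1 / 2 : ℂ) • (B + Complex.I • (1 - D))) 0 1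
        * fromBlocks 1 0 (-Complex.I • 1) 1 := by
  have hI := Complex.I_mul_I
  rw [standardJ, ← fromBlocks_one, sub_eq_add_neg, fromBlocks_neg]
  simp only [fromBlocks_add, fromBlocks_multiply, fromBlocks_smul, fromBlocks_inj]
  refine ⟨?_, ?_, ?_, ?_⟩ <;> ext i j <;>
    simp only [Matrix.add_apply, Matrix.sub_apply, Matrix.neg_apply, Matrix.smul_apply,
      Matrix.mul_smul, Matrix.smul_mul, Matrix.mul_one, Matrix.one_mul, Matrix.zero_mul,
      Matrix.mul_zero, Matrix.neg_mul, Matrix.zero_apply, smul_eq_mul] <;>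
    grind

/-- For a real symplectic `F = [[A,B],[C,D]]` and
`V_F = ½(𝟙 + F + iJ(𝟙 - F))`, one has `det V_F = det(½(A + D + i(B - C)))`. -/
theorem loschmidt_statement_4 (d : ℕ) (A B C D : Matrix (Fin d) (Fin d) ℝ)
    (hF : (Matrix.fromBlocks A B C D)ᵀ * standardJ d ℝ * Matrix.fromBlocks A B C D
        = standardJ d ℝ)
    (V : Matrix (Fin d ⊕ Fin d) (Fin d ⊕ Fin d) ℂ)
    (hV : V = (1 / 2 : ℂ) • (1 + (Matrix.fromBlocks A B C D).map Complex.ofReal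
        + Complex.I • (standardJ d ℂ * (1 - (Matrix.fromBlocks A B C D).map Complex.ofReal)))) :
    V.det = ((1 / 2 : ℂ) • (A.map Complex.ofReal + D.map Complex.ofReal
        + Complex.I • (B.map Complex.ofReal - C.map Complex.ofReal))).det := by
  rw [hV, fromBlocks_map, half_one_add_add_standardJ_mul_eq]
  simp only [det_mul, det_fromBlocks_zero₁₂, det_fromBlocks_zero₂₁, det_one, mul_one, one_mul]
end

section
/- For every real 2d×2d symplectic matrix F, the complex matrix V_F = ½(𝟙 + F + iJ(𝟙 - F)) is invertible. -/
open Matrix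

theorem standardJ_mul_self (d : ℕ) (R : Type*) [CommRing R] :
    standardJ d R * standardJ d R = -1 := by
  simp [standardJ, fromBlocks_multiply, ← fromBlocks_one, fromBlocks_neg]

theorem standardJ_conjTranspose (d : ℕ) : (standardJ d ℂ)ᴴ = -standardJ d ℂ := by
  simp [standardJ, fromBlocks_conjTranspose, fromBlocks_neg]

theorem standardJ_map_ofReal (d : ℕ) :
    (standardJ d ℝ).map Complex.ofReal = standardJ d ℂ := by
  simp only [standardJ, fromBlocks_map]
  congr 1 <;> ext i j <;> simp [Matrix.one_apply, apply_ite Complex.ofReal]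

theorem conjTranspose_mul_standardJ_mul_map_ofReal {d : ℕ}
    {F : Matrix (Fin d ⊕ Fin d) (Fin d ⊕ Fin d) ℝ}
    (hF : Fᵀ * standardJ d ℝ * F = standardJ d ℝ) :
    (F.map Complex.ofReal)ᴴ * standardJ d ℂ * F.map Complex.ofReal = standardJ d ℂ := by
  have hconj : (F.map Complex.ofReal)ᴴ = Fᵀ.map Complex.ofReal := by
    ext i j
    simp
  have h := congrArg (fun M => M.map Complex.ofRealHom) hF
  simp only [Matrix.map_mul] at h
  rw [hconj, ← standardJ_map_ofReal]
  exact h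

/-- If `K` is a Hermitian involution preserved by `G`, then `W = 1 + G + K (1 - G)` satisfies
`Wᴴ W = 2 (1 + Gᴴ G)`. -/
theorem conjTranspose_mul_self_of_involution {n : Type*} [Fintype n] [DecidableEq n]
    {K G : Matrix n n ℂ} (hK : K * K = 1) (hKH : Kᴴ = K) (hG : Gᴴ * K * G = K) :
    (1 + G + K * (1 - G))ᴴ * (1 + G + K * (1 - G)) = (2 : ℂ) • (1 + Gᴴ * G) := by
  have hW : (1 + G + K * (1 - G)) = (1 + K) + (1 - K) * G := by noncomm_ring
  have hWH : (1 + G + K * (1 - G))ᴴ = (1 + K) + Gᴴ * (1 - K) := by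
    rw [hW]
    simp [hKH]
  have h₁ : (1 + K) * (1 + K) = 2 * (1 + K) := by
    rw [show (1 + K) * (1 + K) = 1 + 2 * K + K * K by noncomm_ring, hK]
    noncomm_ring
  have h₂ : (1 + K) * (1 - K) = 0 := by
    rw [show (1 + K) * (1 - K) = 1 - K * K by noncomm_ring, hK, sub_self]
  have h₃ : (1 - K) * (1 + K) = 0 := by
    rw [show (1 - K) * (1 + K) = 1 - K * K by noncomm_ring, hK, sub_self]
  have h₄ : (1 - K) * (1 - K) = 2 * (1 - K) := by
    rw [show (1 - K) * (1 - K) = 1 - 2 * K + K * K by noncomm_ring, hK]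
    noncomm_ring
  calc _ = (1 + K) * (1 + K) + (1 + K) * (1 - K) * G + Gᴴ * ((1 - K) * (1 + K))
        + Gᴴ * ((1 - K) * (1 - K)) * G := by rw [hWH, hW]; noncomm_ring
    _ = 2 * (1 + K) + 2 * (Gᴴ * G - Gᴴ * K * G) := by
      rw [h₁, h₂, h₃, h₄]; noncomm_ring
    _ = _ := by rw [hG, two_smul]; noncomm_ring

open scoped ComplexOrder in
theorem isUnit_one_add_conjTranspose_mul_self {n : Type*} [Fintype n] [DecidableEq n]
    (G : Matrix n n ℂ) : IsUnit (1 + Gᴴ * G) :=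
  (PosDef.one.add_posSemidef (posSemidef_conjTranspose_mul_self G)).isUnit

/-- For every real symplectic `F`, the complex matrix
`V_F = ½(𝟙 + F + iJ(𝟙 - F))` is invertible. -/
theorem loschmidt_statement_8 (d : ℕ) (F : Matrix (Fin d ⊕ Fin d) (Fin d ⊕ Fin d) ℝ)
    (hF : Fᵀ * standardJ d ℝ * F = standardJ d ℝ)
    (V : Matrix (Fin d ⊕ Fin d) (Fin d ⊕ Fin d) ℂ)
    (hV : V = (1 / 2 : ℂ) • (1 + F.map Complex.ofReal
        + Complex.I • (standardJ d ℂ * (1 - F.map Complex.ofReal)))) :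
    IsUnit V := by
  set G := F.map Complex.ofReal with hGdef
  set K := Complex.I • standardJ d ℂ with hKdef
  have hK : K * K = 1 := by
    simp [hKdef, smul_smul, standardJ_mul_self]
  have hKH : Kᴴ = K := by
    simp [hKdef, conjTranspose_smul, standardJ_conjTranspose]
  have hG : Gᴴ * K * G = K := by
    simp [hKdef, hGdef, conjTranspose_mul_standardJ_mul_map_ofReal hF]
  have hmul := conjTranspose_mul_self_of_involution hK hKH hG
  have hunit : IsUnit ((2 : ℂ) • (1 + Gᴴ * G)) :=
    (isUnit_one_add_conjTranspose_mul_self G).smul (Units.mk0 (2 : ℂ) two_ne_zero)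
  rw [← hmul] at hunit
  have hW : IsUnit (1 + G + K * (1 - G)) := by
    rw [isUnit_iff_isUnit_det, det_mul] at hunit
    exact (isUnit_iff_isUnit_det _).2 (isUnit_of_mul_isUnit_right hunit)
  rw [hV, ← smul_mul_assoc]
  exact hW.smul (Units.mk0 (1 / 2 : ℂ) (by norm_num))
end

section
/- Let F be a real 2d×2d symplectic matrix such that 𝟙 + F is invertible. Then the real matrix N = J(𝟙 - F)(𝟙 + F)^{-1} is symmetric. -/
open Matrix

theorem standardJ_transpose (d : ℕ) (R : Type*) [CommRing R] :
    (standardJ d R)ᵀ = -standardJ d R := by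
  simp [standardJ, fromBlocks_transpose, fromBlocks_neg]

/-- If `F` is real symplectic and `𝟙 + F` is invertible, then
`N = J(𝟙 - F)(𝟙 + F)⁻¹` is symmetric. -/
theorem loschmidt_statement_9 (d : ℕ) (F : Matrix (Fin d ⊕ Fin d) (Fin d ⊕ Fin d) ℝ)
    (hF : Fᵀ * standardJ d ℝ * F = standardJ d ℝ)
    (hinv : IsUnit (1 + F))
    (N : Matrix (Fin d ⊕ Fin d) (Fin d ⊕ Fin d) ℝ)
    (hN : N = standardJ d ℝ * (1 - F) * (1 + F)⁻¹) :
    Nᵀ = N := by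
  have hdet : IsUnit (1 + F).det := (isUnit_iff_isUnit_det _).mp hinv
  have hN' : N * (1 + F) = standardJ d ℝ * (1 - F) := by
    rw [hN, nonsing_inv_mul_cancel_right _ _ hdet]
  have hcongr : (1 + F)ᵀ * N * (1 + F) = Fᵀ * standardJ d ℝ - standardJ d ℝ * F := by
    rw [Matrix.mul_assoc, hN', transpose_add, transpose_one]
    calc (1 + Fᵀ) * (standardJ d ℝ * (1 - F))
        = standardJ d ℝ - standardJ d ℝ * F + Fᵀ * standardJ d ℝ
            - Fᵀ * standardJ d ℝ * F := by noncomm_ring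
      _ = Fᵀ * standardJ d ℝ - standardJ d ℝ * F := by rw [hF]; abel
  have hsymm : (1 + F)ᵀ * Nᵀ * (1 + F) = (1 + F)ᵀ * N * (1 + F) := by
    have h := congrArg transpose hcongr
    simp only [transpose_mul, transpose_sub, transpose_transpose, standardJ_transpose] at h
    rw [Matrix.mul_assoc, h, hcongr, Matrix.neg_mul, Matrix.mul_neg]
    abel
  have hinvT : IsUnit (1 + F)ᵀ := (isUnit_transpose _).mpr hinv
  exact hinvT.mul_left_cancel (hinv.mul_right_cancel hsymm)
end

section
/- Let F be a real 2d×2d symplectic matrix with 𝟙 + F invertible, let N = J(𝟙 - F)(𝟙 + F)^{-1}, let K_F = (𝟙 + iN)^{-1}, and let T_F = ((𝟙 + iJ)F^{-1} + 𝟙 - iJ)^{-1}. Then (𝟙 + JN) K_F = 2 T_F. -/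
open Matrix

theorem isUnit_of_transpose_mul_standardJ_mul {d : ℕ} {R : Type*} [CommRing R]
    {F : Matrix (Fin d ⊕ Fin d) (Fin d ⊕ Fin d) R}
    (hF : Fᵀ * standardJ d R * F = standardJ d R) : IsUnit F := by
  refine IsUnit.of_mul_eq_one_right (-(standardJ d R * (Fᵀ * standardJ d R))) ?_
  rw [Matrix.neg_mul, Matrix.mul_assoc, hF, standardJ_mul_self, neg_neg]

theorem map_ofReal_inv {n : Type*} [Fintype n] [DecidableEq n] {A : Matrix n n ℝ}
    (hA : IsUnit A) : (A⁻¹).map Complex.ofReal = (A.map Complex.ofReal)⁻¹ := by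
  refine (Matrix.inv_eq_left_inv ?_).symm
  have h : A⁻¹ * A = 1 := Matrix.nonsing_inv_mul A ((Matrix.isUnit_iff_isUnit_det A).mp hA)
  have hmap := congrArg Complex.ofRealHom.mapMatrix h
  rwa [map_mul, map_one] at hmap

/-- For a real symplectic `F` with `𝟙 + F` invertible, setting
`N = J(𝟙 - F)(𝟙 + F)⁻¹`, `K_F = (𝟙 + iN)⁻¹` and
`T_F = ((𝟙 + iJ)F⁻¹ + 𝟙 - iJ)⁻¹`, one has `(𝟙 + JN) K_F = 2 T_F`. -/
theorem loschmidt_statement_12 (d : ℕ) (F : Matrix (Fin d ⊕ Fin d) (Fin d ⊕ Fin d) ℝ)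
    (hF : Fᵀ * standardJ d ℝ * F = standardJ d ℝ)
    (hinv : IsUnit (1 + F))
    (N : Matrix (Fin d ⊕ Fin d) (Fin d ⊕ Fin d) ℝ)
    (hN : N = standardJ d ℝ * (1 - F) * (1 + F)⁻¹)
    (K : Matrix (Fin d ⊕ Fin d) (Fin d ⊕ Fin d) ℂ)
    (hK : K = (1 + Complex.I • N.map Complex.ofReal)⁻¹)
    (T : Matrix (Fin d ⊕ Fin d) (Fin d ⊕ Fin d) ℂ)
    (hT : T = ((1 + Complex.I • standardJ d ℂ) * (F⁻¹).map Complex.ofReal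
        + 1 - Complex.I • standardJ d ℂ)⁻¹) :
    (1 + standardJ d ℂ * N.map Complex.ofReal) * K = (2 : ℂ) • T := by
  have hJ := standardJ_mul_self d ℂ
  have hFu := isUnit_of_transpose_mul_standardJ_mul hF
  set f := F.map Complex.ofReal
  set j := standardJ d ℂ
  have h1f : (1 + F).map Complex.ofReal = 1 + f :=
    (map_add Complex.ofRealHom.mapMatrix 1 F).trans (by rw [map_one]; rfl)
  have hfu : IsUnit f.det :=
    (Matrix.isUnit_iff_isUnit_det f).mp (hFu.map Complex.ofRealHom.mapMatrix)
  have hgu : IsUnit (1 + f).det :=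
    (Matrix.isUnit_iff_isUnit_det _).mp (h1f ▸ hinv.map Complex.ofRealHom.mapMatrix)
  have hNmap : N.map Complex.ofReal = j * (1 - f) * (1 + f)⁻¹ := by
    have h : Complex.ofRealHom.mapMatrix N = (standardJ d ℝ).map Complex.ofReal *
        (1 - f) * ((1 + F)⁻¹).map Complex.ofReal := by
      rw [hN, map_mul, map_mul, map_sub, map_one]
      rfl
    rw [standardJ_map_ofReal, map_ofReal_inv hinv, h1f] at h
    exact h
  have hg : (1 + f) * (1 + f)⁻¹ = 1 := Matrix.mul_nonsing_inv _ hgu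
  have hginv : (1 + f)⁻¹ * (1 + f) = 1 := Matrix.nonsing_inv_mul _ hgu
  have hf1 : f * f⁻¹ = 1 := Matrix.mul_nonsing_inv _ hfu
  have hJN : 1 + j * N.map Complex.ofReal = (2 : ℂ) • (f * (1 + f)⁻¹) := by
    calc 1 + j * N.map Complex.ofReal
        = (1 + f) * (1 + f)⁻¹ + j * j * (1 - f) * (1 + f)⁻¹ := by
          rw [hNmap, hg]; simp only [Matrix.mul_assoc]
      _ = (2 : ℂ) • (f * (1 + f)⁻¹) := by
          rw [hJ, two_smul]; noncomm_ring
  have hK' : K = (1 + f) * (1 + f + Complex.I • (j * (1 - f)))⁻¹ := by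
    have h : 1 + Complex.I • N.map Complex.ofReal
        = (1 + f + Complex.I • (j * (1 - f))) * (1 + f)⁻¹ := by
      rw [Matrix.add_mul, hg, hNmap, Matrix.smul_mul]
    rw [hK, h, Matrix.mul_inv_rev, Matrix.nonsing_inv_nonsing_inv _ hgu]
  have hT' : T = f * (1 + f + Complex.I • (j * (1 - f)))⁻¹ := by
    have h : (1 + Complex.I • j) * f⁻¹ + 1 - Complex.I • j
        = (1 + f + Complex.I • (j * (1 - f))) * f⁻¹ := by
      have h2 : 1 + f + Complex.I • (j * (1 - f))
          = (1 + Complex.I • j) + (1 - Complex.I • j) * f := by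
        simp only [Matrix.mul_sub, Matrix.sub_mul, Matrix.smul_mul, Matrix.mul_one,
          Matrix.one_mul, smul_sub]
        abel
      rw [h2, Matrix.add_mul (1 + Complex.I • j) ((1 - Complex.I • j) * f), Matrix.mul_assoc _ f, hf1, Matrix.mul_one, add_sub_assoc]
    rw [hT, map_ofReal_inv hFu, h, Matrix.mul_inv_rev, Matrix.nonsing_inv_nonsing_inv _ hfu]
  rw [hJN, hK', hT', Matrix.smul_mul, Matrix.mul_assoc, ← Matrix.mul_assoc (1 + f)⁻¹, hginv,
    Matrix.one_mul]
end

section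
/- Let F be a real 2d×2d symplectic matrix, let Γ_F = (𝟙 + iJ)(𝟙 + F)(𝟙 + F + iJ(𝟙 - F))^{-1}(𝟙 - iJ) - 𝟙, and define the quadratic form γ_F(X) = ¼ X·(Γ_F X) for X ∈ ℝ^{2d}. Then for every X ∈ ℝ^{2d}, Re(γ_F(X)) ≤ -|X|²/(2(1 + s_F)), where s_F = ‖F‖² is the largest eigenvalue of Fᵀ F (the square of the operator norm of F). -/
open Matrix

section Ring

variable {A : Type*} [Ring A] {K f : A}

theorem cayley_mul_one_sub (hK : K * K = 1) :
    (1 + f + K * (1 - f)) * (1 - K) = (1 - K) * (f + K * f * K) := by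
  have h (x : A) : K * (K * x) = x := by rw [← mul_assoc, hK, one_mul]
  simp only [mul_add, add_mul, mul_sub, sub_mul, mul_one, one_mul, mul_assoc, h, hK]
  abel

theorem cayley_mul_one_add (hK : K * K = 1) :
    (1 + f + K * (1 - f)) * (1 + K) = 2 * (1 + K) + (1 - K) * f * (1 + K) := by
  simp only [mul_add, add_mul, mul_sub, sub_mul, mul_one, one_mul, mul_assoc, hK,
    ← one_add_one_eq_two]
  abel

theorem cayley_mul_one_sub_mul (hK : K * K = 1) {r : A} (hr : (f + K * f * K) * r = 1) :
    (1 + f + K * (1 - f)) * ((1 - K) * r) = 1 - K := by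
  rw [← mul_assoc, cayley_mul_one_sub hK, mul_assoc, hr, mul_one]

theorem cayley_mul_rightInverse (hK : K * K = 1) {r : A} (hr : (f + K * f * K) * r = 1) :
    (1 + f + K * (1 - f)) * (2 * ((1 - K) * r) + (1 + K) - (1 - K) * r * f * (1 + K)) = 4 := by
  have h1 := cayley_mul_one_sub_mul hK hr
  have h2 : (1 + f + K * (1 - f)) * ((1 - K) * r * f * (1 + K)) = (1 - K) * f * (1 + K) := by
    rw [mul_assoc _ f, ← mul_assoc, h1, mul_assoc]
  rw [mul_sub, mul_add, two_mul ((1 - K) * r), mul_add, h1, h2, cayley_mul_one_add hK]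
  have h4 : (4 : A) = 1 + 1 + 1 + 1 := by norm_num
  rw [h4, two_mul]
  abel

theorem one_add_mul_one_add_mul_one_sub (hK : K * K = 1) :
    (1 + K) * (1 + f) * (1 - K) = f - K * f * K + (K * f - f * K) := by
  simp only [mul_add, add_mul, mul_sub, mul_one, one_mul, mul_assoc, hK]
  abel

end Ring

section Real

variable {n : Type*} [Fintype n]

theorem dotProduct_real_self_nonneg (x : n → ℝ) : 0 ≤ x ⬝ᵥ x :=
  Finset.sum_nonneg fun i _ => mul_self_nonneg (x i)

theorem dotProduct_mulVec_mulVec (A B : Matrix n n ℝ) (x y : n → ℝ) :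
    (A *ᵥ x) ⬝ᵥ (B *ᵥ y) = x ⬝ᵥ ((Aᵀ * B) *ᵥ y) := by
  rw [← mulVec_mulVec, dotProduct_mulVec x, vecMul_transpose]

theorem re_dotProduct_map_mulVec (A B : Matrix n n ℝ) (x : n → ℝ) :
    ((fun i => (x i : ℂ)) ⬝ᵥ
      ((A.map Complex.ofReal + Complex.I • B.map Complex.ofReal) *ᵥ fun i => (x i : ℂ))).re =
      x ⬝ᵥ (A *ᵥ x) := by
  simp [dotProduct, mulVec]

theorem transpose_mulVec_self_le (F : Matrix n n ℝ) {s : ℝ} (hs : 0 < s)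
    (hF : ∀ x, (F *ᵥ x) ⬝ᵥ (F *ᵥ x) ≤ s * (x ⬝ᵥ x)) (x : n → ℝ) :
    (Fᵀ *ᵥ x) ⬝ᵥ (Fᵀ *ᵥ x) ≤ s * (x ⬝ᵥ x) := by
  have h0 := dotProduct_real_self_nonneg (F *ᵥ (Fᵀ *ᵥ x) - s • x)
  have h1 := hF (Fᵀ *ᵥ x)
  have h2 : x ⬝ᵥ (F *ᵥ (Fᵀ *ᵥ x)) = (Fᵀ *ᵥ x) ⬝ᵥ (Fᵀ *ᵥ x) := by
    rw [dotProduct_mulVec, mulVec_transpose]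
  simp only [dotProduct_sub, sub_dotProduct, smul_dotProduct, dotProduct_smul, smul_eq_mul,
    dotProduct_comm (F *ᵥ (Fᵀ *ᵥ x)) x, h2] at h0
  nlinarith

variable [DecidableEq n]

theorem mulVec_self_le_of_eigenvalues_le (F : Matrix n n ℝ) {s : ℝ}
    (hs : ∀ μ, Module.End.HasEigenvalue (Matrix.toLin' (Fᵀ * F) : Module.End ℝ (n → ℝ)) μ → μ ≤ s)
    (x : n → ℝ) : (F *ᵥ x) ⬝ᵥ (F *ᵥ x) ≤ s * (x ⬝ᵥ x) := by
  have hH : (s • (1 : Matrix n n ℝ) - Fᵀ * F).IsHermitian := by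
    rw [IsHermitian, conjTranspose_eq_transpose_of_trivial]
    simp [transpose_mul]
  have hpos : (s • (1 : Matrix n n ℝ) - Fᵀ * F).PosSemidef := by
    rw [hH.posSemidef_iff_eigenvalues_nonneg]
    intro i
    have hv := hH.mulVec_eigenvectorBasis i
    have hne : (⇑(hH.eigenvectorBasis i) : n → ℝ) ≠ 0 :=
      (WithLp.ofLp_eq_zero 2).ne.2 (hH.eigenvectorBasis.orthonormal.ne_zero i)
    have := hs (s - hH.eigenvalues i) (Module.End.hasEigenvalue_of_hasEigenvector
      (x := ⇑(hH.eigenvectorBasis i)) ⟨Module.End.mem_eigenspace_iff.2 ?_, hne⟩)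
    · simpa using this
    · rw [sub_mulVec, smul_mulVec, one_mulVec] at hv
      rw [toLin'_apply, sub_smul, ← hv, sub_sub_cancel]
  have h := hpos.dotProduct_mulVec_nonneg x
  rw [sub_mulVec, smul_mulVec, one_mulVec, star_trivial, dotProduct_sub, dotProduct_smul,
    smul_eq_mul] at h
  rw [dotProduct_mulVec_mulVec]
  linarith

theorem pos_of_hasEigenvalue_transpose_mul_self {F : Matrix n n ℝ} (hF : IsUnit F) {s : ℝ}
    (hs : Module.End.HasEigenvalue (Matrix.toLin' (Fᵀ * F) : Module.End ℝ (n → ℝ)) s) :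
    0 < s := by
  obtain ⟨v, hv⟩ := hs.exists_hasEigenvector
  have h1 := hv.apply_eq_smul
  rw [toLin'_apply] at h1
  have h2 : (F *ᵥ v) ⬝ᵥ (F *ᵥ v) = s * (v ⬝ᵥ v) := by
    rw [dotProduct_mulVec_mulVec, h1, dotProduct_smul, smul_eq_mul]
  have h3 : F *ᵥ v ≠ 0 := fun h => hv.2 <| mulVec_injective_of_isUnit hF (by simpa using h)
  have h4 : 0 < (F *ᵥ v) ⬝ᵥ (F *ᵥ v) :=
    (dotProduct_real_self_nonneg _).lt_of_ne' (dotProduct_self_eq_zero.not.2 h3)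
  exact pos_of_mul_pos_left (h2 ▸ h4) (dotProduct_real_self_nonneg v)

theorem isUnit_add_of_transpose_mul_eq_one {F G : Matrix n n ℝ} (h : Fᵀ * G = 1) :
    IsUnit (F + G) := by
  have hS : (Fᵀ * (F + G)).PosDef := by
    rw [mul_add, h, add_comm, ← conjTranspose_eq_transpose_of_trivial]
    exact PosDef.one.add_posSemidef (posSemidef_conjTranspose_mul_self F)
  have hu := hS.isUnit
  rw [isUnit_iff_isUnit_det, det_mul] at hu
  rw [isUnit_iff_isUnit_det]
  exact isUnit_of_mul_isUnit_right hu

theorem sub_dotProduct_le_of_transpose_mul_eq_one {F G : Matrix n n ℝ} (h : Fᵀ * G = 1) {s : ℝ}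
    (hs : 0 < s) (hF : ∀ x, (F *ᵥ x) ⬝ᵥ (F *ᵥ x) ≤ s * (x ⬝ᵥ x)) (x : n → ℝ) :
    1 / 4 * (x ⬝ᵥ (((F - G) * (F + G)⁻¹ - 1) *ᵥ x)) ≤ -(x ⬝ᵥ x) / (2 * (1 + s)) := by
  obtain ⟨u, rfl⟩ : ∃ u, x = (F + G) *ᵥ u := ⟨(F + G)⁻¹ *ᵥ x, by
    rw [mulVec_mulVec, mul_nonsing_inv _
      ((isUnit_iff_isUnit_det _).1 (isUnit_add_of_transpose_mul_eq_one h)), one_mulVec]⟩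
  rw [sub_mulVec, one_mulVec, mulVec_mulVec, mul_assoc, nonsing_inv_mul _
      ((isUnit_iff_isUnit_det _).1 (isUnit_add_of_transpose_mul_eq_one h)), mul_one]
  have hFG : (F *ᵥ u) ⬝ᵥ (G *ᵥ u) = u ⬝ᵥ u := by
    rw [dotProduct_mulVec_mulVec, h, one_mulVec]
  have h1 := hF u
  have h2 := transpose_mulVec_self_le F hs hF (G *ᵥ u)
  rw [mulVec_mulVec, h, one_mulVec] at h2
  rw [le_div_iff₀ (by positivity)]
  simp only [add_mulVec, sub_mulVec, dotProduct_sub, dotProduct_add, add_dotProduct,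
    dotProduct_comm (G *ᵥ u) (F *ᵥ u), hFG]
  nlinarith

end Real

/-- For a real symplectic `F`, with
`Γ_F = (𝟙 + iJ)(𝟙 + F)(𝟙 + F + iJ(𝟙 - F))⁻¹(𝟙 - iJ) - 𝟙` and
`γ_F(X) = ¼ X·(Γ_F X)`, one has `Re γ_F(X) ≤ -|X|²/(2(1 + s_F))` for all `X ∈ ℝ^{2d}`,
where `s_F` is the largest eigenvalue of `FᵀF`. -/
theorem loschmidt_statement_14 (d : ℕ) (F : Matrix (Fin d ⊕ Fin d) (Fin d ⊕ Fin d) ℝ)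
    (hF : Fᵀ * standardJ d ℝ * F = standardJ d ℝ)
    (Γ : Matrix (Fin d ⊕ Fin d) (Fin d ⊕ Fin d) ℂ)
    (hΓ : Γ = (1 + Complex.I • standardJ d ℂ) * (1 + F.map Complex.ofReal) *
        (1 + F.map Complex.ofReal
          + Complex.I • (standardJ d ℂ * (1 - F.map Complex.ofReal)))⁻¹ *
        (1 - Complex.I • standardJ d ℂ) - 1)
    (s : ℝ)
    (hs : IsGreatest {μ : ℝ |
      Module.End.HasEigenvalue (Matrix.toLin' (Fᵀ * F) :
        Module.End ℝ ((Fin d ⊕ Fin d) → ℝ)) μ} s) :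
    ∀ X : (Fin d ⊕ Fin d) → ℝ,
      ((1 / 4 : ℂ) * ((fun i => (X i : ℂ)) ⬝ᵥ (Γ *ᵥ fun i => (X i : ℂ)))).re
        ≤ -(X ⬝ᵥ X) / (2 * (1 + s)) := by
  intro X
  set J := standardJ d ℝ with hJ
  set G : Matrix (Fin d ⊕ Fin d) (Fin d ⊕ Fin d) ℝ := -(J * F * J) with hG
  have hFG : Fᵀ * G = 1 := by
    rw [hG, mul_neg, ← mul_assoc, ← mul_assoc, hF, standardJ_mul_self, neg_neg]
  have hFu : IsUnit F := (isUnit_transpose F).1 (IsUnit.of_mul_eq_one _ hFG)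
  have hspos := pos_of_hasEigenvalue_transpose_mul_self hFu hs.1
  have hle := mulVec_self_le_of_eigenvalues_le F fun μ hμ => hs.2 hμ
  have hRu := isUnit_add_of_transpose_mul_eq_one hFG
  set φ := (Complex.ofRealHom.mapMatrix :
    Matrix (Fin d ⊕ Fin d) (Fin d ⊕ Fin d) ℝ →+* Matrix (Fin d ⊕ Fin d) (Fin d ⊕ Fin d) ℂ)
  have hφ (A : Matrix (Fin d ⊕ Fin d) (Fin d ⊕ Fin d) ℝ) : A.map Complex.ofReal = φ A := rfl
  set K := Complex.I • standardJ d ℂ with hK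
  have hKK : K * K = 1 := by
    simp [hK, smul_smul, standardJ_mul_self]
  have hKJ : K = Complex.I • φ J := by rw [hK, ← hφ, standardJ_map_ofReal]
  have hKFK : K * φ F * K = φ G := by
    simp [hKJ, hG, smul_smul]
  have hr : (φ F + K * φ F * K) * φ (F + G)⁻¹ = 1 := by
    rw [hKFK, ← map_add, ← map_mul, mul_nonsing_inv _ ((isUnit_iff_isUnit_det _).1 hRu), map_one]
  have hM : IsUnit (1 + φ F + K * (1 - φ F)) := by
    have h4 := cayley_mul_rightInverse hKK hr
    refine IsUnit.of_mul_eq_one ((4⁻¹ : ℂ) • (2 * ((1 - K) * φ (F + G)⁻¹) + (1 + K)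
      - (1 - K) * φ (F + G)⁻¹ * φ F * (1 + K))) ?_
    rw [mul_smul_comm, h4, inv_smul_eq_iff₀ (by norm_num), Algebra.smul_def, map_ofNat, mul_one]
  have hMinv : (1 + φ F + K * (1 - φ F))⁻¹ * (1 - K) = (1 - K) * φ (F + G)⁻¹ := by
    conv_lhs => rw [← cayley_mul_one_sub_mul hKK hr]
    exact nonsing_inv_mul_cancel_left _ _ ((isUnit_iff_isUnit_det _).1 hM)
  have hΓ' : Γ = ((F - G) * (F + G)⁻¹ - 1).map Complex.ofReal
      + Complex.I • ((J * F - F * J) * (F + G)⁻¹).map Complex.ofReal := by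
    rw [hΓ, ← smul_mul_assoc, ← hK]
    simp only [hφ]
    rw [mul_assoc _ _ (1 - K), hMinv, ← mul_assoc, one_add_mul_one_add_mul_one_sub hKK, hKFK, hKJ]
    simp only [map_sub, map_mul, map_one, smul_mul_assoc, mul_smul_comm, ← smul_sub, add_mul]
    abel
  have hre := re_dotProduct_map_mulVec ((F - G) * (F + G)⁻¹ - 1)
    ((J * F - F * J) * (F + G)⁻¹) X
  rw [← hΓ'] at hre
  have h14 : (1 / 4 : ℂ) = ((1 / 4 : ℝ) : ℂ) := by norm_num
  rw [h14, Complex.re_ofReal_mul, hre]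
  exact sub_dotProduct_le_of_transpose_mul_eq_one hFG hspos hle X
end

section
/- Let F be a real 2d×2d symplectic matrix with d×d block decomposition F = [[A, B],[C, D]]. Then the complex d×d matrix A + iB is invertible, and the matrix Γ = (C + iD)(A + iB)^{-1} is symmetric (Γᵀ = Γ) with positive definite imaginary part Im Γ. -/
open Matrix

/-- The block relations contained in `Fᵀ J F = J`. -/
theorem symplectic_block_relations {d : ℕ} {A B C D : Matrix (Fin d) (Fin d) ℝ}
    (hF : (Matrix.fromBlocks A B C D)ᵀ * standardJ d ℝ * Matrix.fromBlocks A B C D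
        = standardJ d ℝ) :
    Aᵀ * C = Cᵀ * A ∧ Aᵀ * D = 1 + Cᵀ * B ∧ Dᵀ * A = 1 + Bᵀ * C ∧ Bᵀ * D = Dᵀ * B := by
  simp only [standardJ, fromBlocks_transpose, fromBlocks_multiply, fromBlocks_inj, mul_zero,
    mul_one, mul_neg, neg_mul, zero_add, add_zero] at hF
  obtain ⟨h₁, h₂, h₃, h₄⟩ := hF
  refine ⟨?_, ?_, ?_, ?_⟩
  · rw [← sub_eq_zero, ← h₁]; abel
  · rw [← h₂]; abel
  · rw [← neg_inj, neg_add, ← h₃]; abel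
  · rw [← sub_eq_zero, ← h₄]; abel

open scoped ComplexOrder in
/-- If `Xᴴ Y - Yᴴ X = 2i`, then `X` is invertible. -/
theorem isUnit_of_conjTranspose_mul_sub {n : Type*} [Fintype n] [DecidableEq n]
    {X Y : Matrix n n ℂ} (h : Xᴴ * Y - Yᴴ * X = (2 * Complex.I) • (1 : Matrix n n ℂ)) :
    IsUnit X := by
  rw [← mulVec_injective_iff_isUnit, ← coe_mulVecLin, injective_iff_map_eq_zero]
  intro v hv
  rw [mulVecLin_apply] at hv
  have key : star v ⬝ᵥ ((Xᴴ * Y - Yᴴ * X) *ᵥ v) = 0 := by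
    rw [sub_mulVec, dotProduct_sub, ← mulVec_mulVec, ← mulVec_mulVec, hv, mulVec_zero,
      dotProduct_zero, dotProduct_mulVec, ← star_mulVec, hv, star_zero, zero_dotProduct, sub_zero]
  rw [h, smul_mulVec, one_mulVec, dotProduct_smul, smul_eq_mul] at key
  have h2 : (2 * Complex.I) ≠ 0 := by simp
  exact dotProduct_star_self_eq_zero.mp ((mul_eq_zero.mp key).resolve_left h2)

open scoped ComplexOrder in
/-- A real matrix is positive definite if its complexification is `Zᴴ Z` with `Z` invertible. -/
theorem posDef_of_map_ofReal_eq {n : Type*} [Fintype n] [DecidableEq n] {M : Matrix n n ℝ}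
    {Z : Matrix n n ℂ} (hZ : IsUnit Z) (hM : M.map Complex.ofReal = Zᴴ * Z) : M.PosDef := by
  have h : (M.map Complex.ofReal).PosDef :=
    hM ▸ PosDef.conjTranspose_mul_self Z (mulVec_injective_of_isUnit hZ)
  refine PosDef.of_dotProduct_mulVec_pos ?_ fun x hx => ?_
  · ext i j
    have := congrFun (congrFun h.isHermitian i) j
    simpa using this
  · have hx' : (fun i => (x i : ℂ)) ≠ 0 := fun h0 => hx <| by
      ext i
      simpa using congrFun h0 i
    have hpos := h.dotProduct_mulVec_pos hx'
    have hcast : star (fun i => (x i : ℂ)) ⬝ᵥ (M.map Complex.ofReal *ᵥ fun i => (x i : ℂ))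
        = ((star x ⬝ᵥ (M *ᵥ x) : ℝ) : ℂ) := by
      simp [dotProduct, mulVec]
    rw [hcast] at hpos
    exact_mod_cast hpos

/-- For a real symplectic `F = [[A,B],[C,D]]`, the matrix `A + iB`
is invertible and `Γ = (C + iD)(A + iB)⁻¹` is symmetric with positive definite
imaginary part. -/
theorem loschmidt_statement_17 (d : ℕ) (A B C D : Matrix (Fin d) (Fin d) ℝ)
    (hF : (Matrix.fromBlocks A B C D)ᵀ * standardJ d ℝ * Matrix.fromBlocks A B C D
        = standardJ d ℝ)
    (Γ : Matrix (Fin d) (Fin d) ℂ)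
    (hΓ : Γ = (C.map Complex.ofReal + Complex.I • D.map Complex.ofReal) *
        (A.map Complex.ofReal + Complex.I • B.map Complex.ofReal)⁻¹) :
    IsUnit (A.map Complex.ofReal + Complex.I • B.map Complex.ofReal) ∧
    Γᵀ = Γ ∧ (Γ.map Complex.im).PosDef := by
  obtain ⟨h₁, h₂, h₃, h₄⟩ := symplectic_block_relations hF
  have castMul (M N : Matrix (Fin d) (Fin d) ℝ) :
      (M * N).map Complex.ofReal = M.map Complex.ofReal * N.map Complex.ofReal :=
    Matrix.map_mul (f := Complex.ofRealHom)
  have castAdd (M N : Matrix (Fin d) (Fin d) ℝ) :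
      (M + N).map Complex.ofReal = M.map Complex.ofReal + N.map Complex.ofReal :=
    Matrix.map_add _ Complex.ofReal_add M N
  have castOne : (1 : Matrix (Fin d) (Fin d) ℝ).map Complex.ofReal = 1 :=
    Matrix.map_one _ Complex.ofReal_zero Complex.ofReal_one
  have castConj (M : Matrix (Fin d) (Fin d) ℝ) :
      (M.map Complex.ofReal)ᴴ = (M.map Complex.ofReal)ᵀ := by
    ext i j
    simp
  replace h₁ := congrArg (fun M => M.map Complex.ofReal) h₁
  replace h₂ := congrArg (fun M => M.map Complex.ofReal) h₂
  replace h₃ := congrArg (fun M => M.map Complex.ofReal) h₃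
  replace h₄ := congrArg (fun M => M.map Complex.ofReal) h₄
  simp only [castMul, castAdd, castOne, transpose_map] at h₁ h₂ h₃ h₄
  set X := A.map Complex.ofReal + Complex.I • B.map Complex.ofReal with hX
  set Y := C.map Complex.ofReal + Complex.I • D.map Complex.ofReal with hY
  have hsymm : Xᵀ * Y = Yᵀ * X := by
    simp only [hX, hY, transpose_add, transpose_smul, add_mul, mul_add, Matrix.smul_mul, Matrix.mul_smul,
      h₁, h₂, h₃, h₄]
    module
  have hherm : Xᴴ * Y - Yᴴ * X = (2 * Complex.I) • (1 : Matrix (Fin d) (Fin d) ℂ) := by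
    simp only [hX, hY, conjTranspose_add, conjTranspose_smul, castConj, add_mul, mul_add,
      Matrix.smul_mul, Matrix.mul_smul, h₁, h₂, h₃, h₄, Complex.star_def, Complex.conj_I]
    module
  have hunit : IsUnit X := isUnit_of_conjTranspose_mul_sub hherm
  have hdet : IsUnit X.det := (isUnit_iff_isUnit_det X).mp hunit
  have hΓX : Γ * X = Y := by rw [hΓ, nonsing_inv_mul_cancel_right _ _ hdet]
  have hΓsymm : Γᵀ = Γ := by
    apply hunit.mul_right_cancel
    apply ((isUnit_transpose X).mpr hunit).mul_left_cancel
    rw [hΓX, hsymm, ← mul_assoc, ← transpose_mul, hΓX]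
  refine ⟨hunit, hΓsymm, posDef_of_map_ofReal_eq (isUnit_nonsing_inv_iff.mpr hunit) ?_⟩
  have hsub : Γ - Γᴴ = (2 * Complex.I) • (Γ.map Complex.im).map Complex.ofReal := by
    ext i j
    have hij : Γ j i = Γ i j := congrFun (congrFun hΓsymm i) j
    simp only [Matrix.sub_apply, conjTranspose_apply, hij, Matrix.smul_apply, map_apply, smul_eq_mul,
      Complex.star_def, Complex.sub_conj]
    push_cast
    ring
  have hconj : Γ - Γᴴ = (2 * Complex.I) • ((X⁻¹)ᴴ * X⁻¹) := by
    have hl : (X⁻¹)ᴴ * Xᴴ = 1 := by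
      rw [← conjTranspose_mul, mul_nonsing_inv _ hdet, conjTranspose_one]
    have hr : X * X⁻¹ = 1 := mul_nonsing_inv _ hdet
    calc Γ - Γᴴ = ((X⁻¹)ᴴ * Xᴴ) * (Γ - Γᴴ) * (X * X⁻¹) := by rw [hl, hr, one_mul, mul_one]
      _ = (X⁻¹)ᴴ * (Xᴴ * (Γ * X) - (Γ * X)ᴴ * X) * X⁻¹ := by
        rw [conjTranspose_mul]
        noncomm_ring
      _ = (2 * Complex.I) • ((X⁻¹)ᴴ * X⁻¹) := by
        rw [hΓX, hherm, Matrix.mul_smul, mul_one, Matrix.smul_mul]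
  have h2 : (2 * Complex.I) ≠ 0 := by simp
  exact smul_right_injective _ h2 (hsub.symm.trans hconj)
end
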